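/- The map ℤ_p(1) → T_p(Ω¹_{O_K̄/O_K}) induced by dlog on p^r-torsion subgroups extends, after scalar extension along ℤ_p → C_K, to an isomorphism of C_K-vector spaces C_K ⊗_{ℤ_p} ℤ_p(1) ≅ V_p(Ω¹_{O_K̄/O_K}). -/

import Mathlib

/-- The Tate module `T_p(M) = lim_r M[p^r]` of a module `M` over a commutative ring
`R`, realized as the `R`-submodule of `ℕ → M` consisting of sequences `(x_r)` with
`p • x_{r+1} = x_r` and `p^r • x_r = 0`. -/
def TateModule (p : ℕ) (R : Type*) [CommRing R] (M : Type*) [AddCommGroup M]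
    [Module R M] : Submodule R (ℕ → M) where
  carrier := {f | (∀ r, p • f (r + 1) = f r) ∧ ∀ r, p ^ r • f r = 0}
  add_mem' := by
    intro f g hf hg
    refine ⟨fun r => ?_, fun r => ?_⟩
    · simp only [Pi.add_apply, smul_add, hf.1 r, hg.1 r]
    · simp only [Pi.add_apply, smul_add, hf.2 r, hg.2 r, add_zero]
  zero_mem' := by
    refine ⟨fun r => ?_, fun r => ?_⟩ <;> simp
  smul_mem' := by
    intro c f hf
    refine ⟨fun r => ?_, fun r => ?_⟩
    · simp only [Pi.smul_apply]
      rw [smul_comm, hf.1 r]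
    · simp only [Pi.smul_apply]
      rw [smul_comm, hf.2 r, smul_zero]

section Differentials

open Polynomial KaehlerDifferential

/-- If the quotient of a domain `R` by a nonzero principal ideal `(π)` embeds in a principal ideal
domain, then `π` lies in the square of no proper ideal containing it. -/
theorem not_mem_sq_of_surjective {R A : Type*} [CommRing R] [IsDomain R] [CommRing A] [IsDomain A]
    [IsPrincipalIdealRing A] (f : R →+* A) (hf : Function.Surjective f) {π : R} (hπ : π ≠ 0)
    (hker : RingHom.ker f = Ideal.span {π}) {I : Ideal R} (hI : I ≠ ⊤) (hmem : π ∈ I) :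
    π ∉ I ^ 2 := by
  intro h
  have hfπ : f π = 0 := by
    rw [← RingHom.mem_ker, hker]; exact Ideal.mem_span_singleton_self π
  obtain ⟨c, hc⟩ := (IsPrincipalIdealRing.principal (I.map f)).principal
  have hcI : c ∈ I.map f := by rw [hc]; exact Submodule.mem_span_singleton_self c
  obtain ⟨φ, hφI, rfl⟩ := (Ideal.mem_map_iff_of_surjective f hf).1 hcI
  have hIspan : I = Ideal.span {π, φ} := by
    apply le_antisymm
    · intro y hy
      have : f y ∈ I.map f := Ideal.mem_map_of_mem f hy
      rw [hc] at this
      obtain ⟨d, hd⟩ := Submodule.mem_span_singleton.1 this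
      obtain ⟨d, rfl⟩ := hf d
      have : y - d * φ ∈ RingHom.ker f := by
        rw [RingHom.mem_ker, map_sub, map_mul, ← hd, smul_eq_mul, sub_self]
      rw [hker] at this
      obtain ⟨e, he⟩ := Ideal.mem_span_singleton'.1 this
      exact Ideal.mem_span_pair.2 ⟨e, d, by rw [he]; ring⟩
    · rw [Ideal.span_le]
      rintro y (rfl | rfl)
      exacts [hmem, hφI]
  have key : ∃ a b c : R, π = a * (π * π) + b * (π * φ) + c * (φ * φ) := by
    rw [sq, hIspan, Ideal.span_pair_mul_span_pair] at h
    simp only [Ideal.mem_span_insert, Ideal.mem_span_singleton'] at h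
    obtain ⟨a, _, ⟨b, _, ⟨c, _, ⟨d, rfl⟩, rfl⟩, rfl⟩, h⟩ := h
    exact ⟨a, b + c, d, h.trans (by ring)⟩
  obtain ⟨a, b, c, habc⟩ := key
  have h1 : f c * (f φ * f φ) = 0 := by
    have := congrArg f habc
    simpa [hfπ] using this.symm
  have h2 : ∃ c', c * φ = π * c' := by
    have : c * φ ∈ RingHom.ker f := by
      rw [RingHom.mem_ker, map_mul]
      rcases mul_eq_zero.1 h1 with h | h
      · rw [h, zero_mul]
      · rw [mul_self_eq_zero.1 h, mul_zero]
    rw [hker] at this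
    exact Ideal.mem_span_singleton.1 this
  obtain ⟨c', hc'⟩ := h2
  have h3 : π * (a * π + b * φ + c' * φ) = π * 1 := by
    linear_combination φ * (-hc') - habc
  have h4 := mul_left_cancel₀ hπ h3
  apply hI
  rw [Ideal.eq_top_iff_one, ← h4]
  exact I.add_mem (I.add_mem (I.mul_mem_left _ hmem) (I.mul_mem_left _ hφI)) (I.mul_mem_left _ hφI)

/-- The `p ^ (r + 1)`-st cyclotomic polynomial is Eisenstein at `X - 1`. -/
theorem exists_cyclotomic_eq (p : ℕ) [hp : Fact p.Prime] (r : ℕ) :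
    ∃ s : ℤ[X], cyclotomic (p ^ (r + 1)) ℤ =
      (X - 1) ^ (p ^ r * (p - 1)) + (p : ℤ[X]) * s ∧ s.eval 1 = 1 := by
  have hp0 : (p : ℤ) ≠ 0 := by exact_mod_cast hp.1.ne_zero
  have h : ∃ s : ℤ[X], cyclotomic (p ^ (r + 1)) ℤ - (X - 1) ^ (p ^ r * (p - 1)) = C (p : ℤ) * s := by
    apply (C_dvd_iff_dvd_coeff _ _).2
    intro i
    rw [← ZMod.intCast_zmod_eq_zero_iff_dvd, ← eq_intCast (Int.castRingHom (ZMod p)), ← coeff_map]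
    have := cyclotomic_mul_prime_pow_eq (ZMod p) (p := p) (m := 1)
      (by simpa using hp.1.one_lt.ne') (Nat.succ_pos r)
    simp only [mul_one, cyclotomic_one, Nat.succ_eq_add_one, Nat.add_sub_cancel] at this
    simp only [Polynomial.map_sub, map_cyclotomic, Polynomial.map_pow, Polynomial.map_X,
      Polynomial.map_one]
    rw [this, pow_succ, ← Nat.mul_sub_one, sub_self, coeff_zero]
  obtain ⟨s, hs⟩ := h
  refine ⟨s, by rw [← sub_eq_iff_eq_add', hs]; simp, ?_⟩
  have := congrArg (eval 1) hs
  have he : p ^ r * (p - 1) ≠ 0 :=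
    mul_ne_zero (pow_ne_zero _ hp.1.ne_zero) (Nat.sub_ne_zero_of_lt hp.1.one_lt)
  rw [eval_sub, eval_one_cyclotomic_prime_pow] at this
  simp only [eval_pow, eval_sub, eval_X, eval_one, sub_self, zero_pow he, sub_zero, eval_mul,
    eval_C] at this
  exact mul_left_cancel₀ hp0 (by rw [← this, mul_one])

theorem natCast_mem_of_isMaximal (p : ℕ) [Fact p.Prime] {B : Type*} [CommRing B]
    [Algebra ℤ_[p] B] [Algebra.IsIntegral ℤ_[p] B] (m : Ideal B) [m.IsMaximal] : (p : B) ∈ m := by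
  have h := Ideal.isMaximal_comap_of_isIntegral_of_isMaximal (R := ℤ_[p]) m
  have h2 := IsLocalRing.eq_maximalIdeal h
  have h3 : (p : ℤ_[p]) ∈ m.comap (algebraMap ℤ_[p] B) := by
    rw [h2, PadicInt.maximalIdeal_eq_span_p]; exact Ideal.mem_span_singleton_self _
  simpa using h3

/-- The cofactor of the minimal equation of `x` in the cyclotomic equation of `h(x)` is a unit
at `x`. -/
theorem isUnit_aeval_of_mul_eq_cyclotomic_comp (p : ℕ) [Fact p.Prime] {B : Type*} [CommRing B]
    [Algebra ℤ_[p] B] [Algebra.IsIntegral ℤ_[p] B] {r : ℕ} (hr : 2 ≤ p ^ r * (p - 1))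
    {x : B} {g k h : ℤ_[p][X]} (hg : aeval x g = 0)
    (hgk : g * k = (cyclotomic (p ^ (r + 1)) ℤ_[p]).comp h) : IsUnit (aeval x k) := by
  by_contra hk
  obtain ⟨m, hm, hkm⟩ := exists_max_ideal_of_mem_nonunits hk
  have hpm := natCast_mem_of_isMaximal p m
  set I : Ideal ℤ_[p][X] := m.comap (aeval x) with hI
  have hprime : I.IsPrime := Ideal.comap_isPrime _ _
  have hpI : (p : ℤ_[p][X]) ∈ I := by simpa [hI] using hpm
  have hgI : g ∈ I := by simp [hI, hg]
  have hkI : k ∈ I := by simpa [hI] using hkm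
  obtain ⟨s, hs, hs1⟩ := exists_cyclotomic_eq p r
  set e := p ^ r * (p - 1) with he
  set s' : ℤ_[p][X] := s.map (Int.castRingHom ℤ_[p]) with hs'
  have hs1' : s'.eval 1 = 1 := by
    rw [hs', eval_one_map, hs1, map_one]
  obtain ⟨y, hy⟩ : h - 1 ∣ s'.comp h - 1 := by
    have : h - C 1 ∣ s'.comp h - s'.comp (C 1) := by
      simp only [comp, eval₂_eq_eval_map]
      exact sub_dvd_eval_sub _ _ _
    simpa [hs1'] using this
  have key : g * k = (h - 1) ^ e + (p : ℤ_[p][X]) * (1 + (h - 1) * y) := by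
    rw [hgk, ← map_cyclotomic_int, hs, ← hy]
    simp [hs']
  have hH : h - 1 ∈ I := by
    apply hprime.mem_of_pow_mem e
    have : (h - 1) ^ e = g * k - (p : ℤ_[p][X]) * (1 + (h - 1) * y) := by rw [key]; ring
    rw [this]
    exact I.sub_mem (I.mul_mem_right _ hgI) (I.mul_mem_right _ hpI)
  refine not_mem_sq_of_surjective (mapRingHom (PadicInt.toZMod (p := p)))
    (map_surjective _ (ZMod.ringHom_surjective _)) (π := (p : ℤ_[p][X])) ?_ ?_ hprime.ne_top hpI ?_
  · exact_mod_cast (Fact.out : p.Prime).ne_zero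
  · rw [ker_mapRingHom, PadicInt.ker_toZMod, PadicInt.maximalIdeal_eq_span_p, Ideal.map_span]
    simp
  · have : (p : ℤ_[p][X]) = g * k - (h - 1) ^ e - p * ((h - 1) * y) := by rw [key]; ring
    rw [this]
    refine (I ^ 2).sub_mem ((I ^ 2).sub_mem ?_ ?_) ?_
    · rw [sq]; exact Ideal.mul_mem_mul hgI hkI
    · exact Ideal.pow_le_pow_right hr (Ideal.pow_mem_pow hH e)
    · rw [sq]; exact Ideal.mul_mem_mul hpI (I.mul_mem_right _ hH)

theorem aeval_derivative_minpoly_ne_zero {R B : Type*} [CommRing R] [IsDomain R]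
    [IsIntegrallyClosed R] [CharZero R] [CommRing B] [IsDomain B] [Algebra R B] [FaithfulSMul R B]
    {x : B} (hx : IsIntegral R x) : aeval x (derivative (minpoly R x)) ≠ 0 := by
  intro h
  have hdvd := minpoly.isIntegrallyClosed_dvd hx h
  have h0 : derivative (minpoly R x) ≠ 0 := fun h0 =>
    (minpoly.natDegree_pos hx).ne' (derivative_eq_zero.1 h0)
  exact (degree_le_of_dvd hdvd h0).not_gt (degree_derivative_lt (minpoly.ne_zero hx))

/-- If `a · h'(x)` is divisible by the derivative of the minimal polynomial of `x` at `x`, where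
`h(x) = ζ` is a root of the cyclotomic polynomial, then `Φ'(ζ)` divides `a`. -/
theorem derivative_cyclotomic_dvd (p : ℕ) [Fact p.Prime] {B : Type*} [CommRing B] [IsDomain B]
    [Algebra ℤ_[p] B] [Algebra.IsIntegral ℤ_[p] B] [FaithfulSMul ℤ_[p] B] {r : ℕ}
    (hr : 2 ≤ p ^ r * (p - 1)) {x a : B} {h : ℤ_[p][X]}
    (hζ : aeval (aeval x h) (cyclotomic (p ^ (r + 1)) ℤ_[p]) = 0)
    (ha : aeval x (derivative (minpoly ℤ_[p] x)) ∣ a * aeval x (derivative h)) :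
    aeval (aeval x h) (derivative (cyclotomic (p ^ (r + 1)) ℤ_[p])) ∣ a := by
  have hx : IsIntegral ℤ_[p] x := Algebra.IsIntegral.isIntegral x
  set g := minpoly ℤ_[p] x with hg
  have hg0 : aeval x g = 0 := minpoly.aeval _ _
  obtain ⟨k, hk⟩ : g ∣ (cyclotomic (p ^ (r + 1)) ℤ_[p]).comp h :=
    minpoly.isIntegrallyClosed_dvd hx (by rw [aeval_comp, hζ])
  obtain ⟨u, hu⟩ := isUnit_aeval_of_mul_eq_cyclotomic_comp p hr hg0 hk.symm
  have hder : aeval (aeval x h) (derivative (cyclotomic (p ^ (r + 1)) ℤ_[p])) *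
      aeval x (derivative h) = aeval x (derivative g) * u := by
    have := congrArg (fun q => aeval x (derivative q)) hk
    simp only [derivative_comp, derivative_mul, map_mul, map_add, hg0, zero_mul, add_zero,
      aeval_comp] at this
    rw [mul_comm, this, hu]
  have hg' : aeval x (derivative g) ≠ 0 := aeval_derivative_minpoly_ne_zero hx
  obtain ⟨b, hb⟩ := ha
  have hh : aeval x (derivative h) ≠ 0 := by
    intro h0
    rw [h0, mul_zero] at hder
    exact mul_ne_zero hg' u.ne_zero hder.symm
  refine ⟨↑u⁻¹ * b, mul_right_cancel₀ hh ?_⟩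
  rw [hb]
  have : (u : B) * ↑u⁻¹ = 1 := u.mul_inv
  linear_combination (-aeval x (derivative g) * b) * this - (↑u⁻¹ * b) * hder

theorem pow_dvd_of_derivative_cyclotomic_dvd (p : ℕ) [Fact p.Prime] {B : Type*} [CommRing B]
    [IsDomain B] [Algebra ℤ_[p] B] {r : ℕ} {ζ a : B} (hζ : IsPrimitiveRoot ζ (p ^ (r + 1)))
    (ha : aeval ζ (derivative (cyclotomic (p ^ (r + 1)) ℤ_[p])) ∣ a) :
    (p : B) ^ (r + 1) ∣ p * a := by
  have h1 := congrArg (fun q => aeval ζ (derivative q))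
    (cyclotomic_prime_pow_mul_X_pow_sub_one ℤ_[p] p r)
  have hroot : aeval ζ (cyclotomic (p ^ (r + 1)) ℤ_[p]) = 0 := by
    rw [aeval_def, eval₂_eq_eval_map, map_cyclotomic]
    exact hζ.isRoot_cyclotomic (pow_pos (Fact.out : p.Prime).pos _)
  simp only [derivative_mul, map_mul, map_add, hroot, zero_mul, add_zero,
    derivative_X_pow, derivative_one, sub_zero, map_sub, map_pow, aeval_X, map_one,
    map_natCast] at h1
  have hη : IsPrimitiveRoot (ζ ^ p ^ r) p :=
    hζ.pow (by have := (Fact.out : p.Prime).pos; positivity) (pow_succ _ _)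
  have hdvd : ζ ^ p ^ r - 1 ∣ (p : B) := by
    have h2 := sub_dvd_eval_sub (1 : B) (ζ ^ p ^ r) (cyclotomic p B)
    rw [eval_one_cyclotomic_prime, (hη.isRoot_cyclotomic (Fact.out : p.Prime).pos).eq_zero,
      sub_zero] at h2
    rwa [← neg_sub, neg_dvd] at h2
  have h3 : (p : B) ^ (r + 1) ∣ a * (ζ ^ p ^ r - 1) := by
    obtain ⟨b, rfl⟩ := ha
    rw [mul_right_comm, h1, Nat.cast_pow]
    exact dvd_mul_of_dvd_left (dvd_mul_right _ _) _
  rw [mul_comm]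
  exact h3.trans (mul_dvd_mul_left a hdvd)

theorem exists_map_aeval_eq_derivative (p : ℕ) [Fact p.Prime] {B : Type*} [CommRing B] [IsDomain B]
    [Algebra ℤ_[p] B] [Algebra.IsIntegral ℤ_[p] B] [FaithfulSMul ℤ_[p] B] (x : B) :
    ∃ D : B → B ⧸ Ideal.span {aeval x (derivative (minpoly ℤ_[p] x))},
      ∀ h : ℤ_[p][X], D (aeval x h) = Ideal.Quotient.mk _ (aeval x (derivative h)) := by
  classical
  have hx : IsIntegral ℤ_[p] x := Algebra.IsIntegral.isIntegral x
  refine ⟨fun y => if h : ∃ q : ℤ_[p][X], aeval x q = y then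
    Ideal.Quotient.mk _ (aeval x (derivative h.choose)) else 0, fun h => ?_⟩
  have hex : ∃ q : ℤ_[p][X], aeval x q = aeval x h := ⟨h, rfl⟩
  beta_reduce
  rw [dif_pos hex, Ideal.Quotient.eq, ← map_sub, ← derivative_sub]
  obtain ⟨k, hk⟩ := minpoly.isIntegrallyClosed_dvd hx (p := hex.choose - h)
    (by rw [map_sub, hex.choose_spec, sub_self])
  rw [hk, derivative_mul, map_add, map_mul, map_mul, minpoly.aeval, zero_mul, add_zero]
  exact Ideal.mul_mem_right _ _ (Ideal.mem_span_singleton_self _)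

theorem exists_finset_linearCombination_eq_zero {R B : Type*} [CommRing R] [CommRing B]
    [Algebra R B] {u : B →₀ B} (hu : u ∈ KaehlerDifferential.kerTotal R B) :
    ∃ s : Finset B, ∀ S : Subalgebra R B, ↑s ⊆ (S : Set B) →
      ∀ (N : Type _) [AddCommGroup N] [Module B N] (D : B → N),
        (∀ y ∈ S, ∀ z ∈ S, D (y + z) = D y + D z) →
        (∀ y ∈ S, ∀ z ∈ S, D (y * z) = y • D z + z • D y) →
        (∀ c : R, D (algebraMap R B c) = 0) → Finsupp.linearCombination B D u = 0 := by
  classical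
  induction hu using Submodule.span_induction with
  | mem u hu =>
    rcases hu with (⟨⟨y, z⟩, rfl⟩ | ⟨⟨y, z⟩, rfl⟩) | ⟨c, rfl⟩
    · refine ⟨{y, z}, fun S hS N _ _ D h1 h2 h3 => ?_⟩
      simp [h1 y (hS (by simp)) z (hS (by simp))]
    · refine ⟨{y, z}, fun S hS N _ _ D h1 h2 h3 => ?_⟩
      simp [h2 y (hS (by simp)) z (hS (by simp))]
    · exact ⟨∅, fun S hS N _ _ D h1 h2 h3 => by simp [h3]⟩
  | zero => exact ⟨∅, by simp⟩
  | add u v _ _ hu hv =>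
    obtain ⟨s, hs⟩ := hu
    obtain ⟨t, ht⟩ := hv
    refine ⟨s ∪ t, fun S hS N _ _ D h1 h2 h3 => ?_⟩
    rw [Finset.coe_union, Set.union_subset_iff] at hS
    rw [map_add, hs S hS.1 N D h1 h2 h3, ht S hS.2 N D h1 h2 h3, add_zero]
  | smul b u _ hu =>
    obtain ⟨s, hs⟩ := hu
    exact ⟨s, fun S hS N _ _ D h1 h2 h3 => by rw [map_smul, hs S hS N D h1 h2 h3, smul_zero]⟩

/-- Over `ℤ_p`, the annihilator of `dζ` for a primitive `p ^ r`-th root of unity `ζ` is contained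
in `(p ^ (r - 1))`, for every integral extension that is a union of monogenic ones. -/
theorem pow_dvd_of_smul_D_eq_zero (p : ℕ) [Fact p.Prime] {B : Type*} [CommRing B] [IsDomain B]
    [Algebra ℤ_[p] B] [Algebra.IsIntegral ℤ_[p] B] [FaithfulSMul ℤ_[p] B]
    (hB : ∀ s : Finset B, ∃ x : B, (s : Set B) ⊆ Algebra.adjoin ℤ_[p] {x})
    {r : ℕ} {ζ a : B} (hζ : IsPrimitiveRoot ζ (p ^ r))
    (ha : a • KaehlerDifferential.D ℤ_[p] B ζ = 0) : (p : B) ^ r ∣ p * a := by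
  classical
  obtain _ | _ | r := r
  · simp
  · simp
  have hp := (Fact.out : p.Prime).two_le
  have hr : 2 ≤ p ^ (r + 1) * (p - 1) :=
    (hp.trans (Nat.le_self_pow (Nat.succ_ne_zero r) p)).trans
      (Nat.le_mul_of_pos_right _ (by omega))
  have hmem : Finsupp.single ζ a ∈ KaehlerDifferential.kerTotal ℤ_[p] B := by
    have h := KaehlerDifferential.kerTotal_eq ℤ_[p] B
    rw [← h]
    simp [ha]
  obtain ⟨s, hs⟩ := exists_finset_linearCombination_eq_zero hmem
  obtain ⟨x, hx⟩ := hB (insert ζ s)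
  rw [Finset.coe_insert, Set.insert_subset_iff] at hx
  obtain ⟨D, hD⟩ := exists_map_aeval_eq_derivative p x
  have hS : ∀ y ∈ Algebra.adjoin ℤ_[p] {x}, ∃ h : ℤ_[p][X], aeval x h = y := fun y hy => by
    rwa [Algebra.adjoin_singleton_eq_range_aeval] at hy
  have hsmul (b y : B) : b • Ideal.Quotient.mk
      (Ideal.span {aeval x (derivative (minpoly ℤ_[p] x))}) y = Ideal.Quotient.mk _ (b * y) := rfl
  have h0 := hs _ hx.2 _ D ?_ ?_ ?_
  · obtain ⟨h, rfl⟩ := hS _ hx.1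
    rw [Finsupp.linearCombination_single, hD, hsmul,
      Ideal.Quotient.eq_zero_iff_mem, Ideal.mem_span_singleton] at h0
    refine pow_dvd_of_derivative_cyclotomic_dvd p hζ (derivative_cyclotomic_dvd p hr ?_ h0)
    rw [aeval_def, eval₂_eq_eval_map, map_cyclotomic]
    exact hζ.isRoot_cyclotomic (pow_pos (Fact.out : p.Prime).pos _)
  · intro y hy z hz
    obtain ⟨f, rfl⟩ := hS y hy
    obtain ⟨g, rfl⟩ := hS z hz
    rw [← map_add, hD, hD, hD, derivative_add, map_add, map_add]
  · intro y hy z hz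
    obtain ⟨f, rfl⟩ := hS y hy
    obtain ⟨g, rfl⟩ := hS z hz
    rw [← map_mul, hD, hD, hD, derivative_mul, map_add, map_mul, map_mul, map_add,
      hsmul, hsmul, add_comm, mul_comm (aeval x (derivative f))]
  · intro c
    rw [← aeval_C x c, hD]
    simp

theorem exists_dvd_natCast_pow (p : ℕ) [Fact p.Prime] {B : Type*} [CommRing B] [IsDomain B]
    [Algebra ℤ_[p] B] [Algebra.IsIntegral ℤ_[p] B] [FaithfulSMul ℤ_[p] B] {b : B} (hb : b ≠ 0) :
    ∃ n : ℕ, b ∣ (p : B) ^ n := by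
  have hbint : IsIntegral ℤ_[p] b := Algebra.IsIntegral.isIntegral b
  have hne := Ideal.comap_ne_bot_of_integral_mem hb (Ideal.mem_span_singleton_self b) hbint
  obtain ⟨z, hz, h0⟩ := Submodule.exists_mem_ne_zero_of_ne_bot hne
  have hdvd : b ∣ algebraMap ℤ_[p] B z := Ideal.mem_span_singleton.1 hz
  rw [PadicInt.unitCoeff_spec h0, map_mul, map_pow, map_natCast] at hdvd
  exact ⟨_, ((((PadicInt.unitCoeff h0).isUnit.map (algebraMap ℤ_[p] B)).dvd_mul_left).1 hdvd)⟩

/-- Passing from `ℤ_p` to a finite extension `A` as the base changes annihilators of differentials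
only by a bounded power of `p`. -/
theorem exists_pow_smul_D_eq_zero (p : ℕ) [Fact p.Prime] (A : Type*) {B : Type*} [CommRing A]
    [CommRing B] [IsDomain B]
    [Algebra ℤ_[p] B] [Algebra.IsIntegral ℤ_[p] B] [FaithfulSMul ℤ_[p] B]
    (hB : ∀ s : Finset B, ∃ x : B, (s : Set B) ⊆ Algebra.adjoin ℤ_[p] {x})
    [Algebra ℤ_[p] A] [Module.Finite ℤ_[p] A] [Algebra A B] [IsScalarTower ℤ_[p] A B] :
    ∃ c : ℕ, ∀ y a : B, a • KaehlerDifferential.D A B y = 0 →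
      ((p : B) ^ c * a) • KaehlerDifferential.D ℤ_[p] B y = 0 := by
  classical
  obtain ⟨s, hs⟩ := Module.Finite.fg_top (R := ℤ_[p]) (M := A)
  obtain ⟨x, hx⟩ := hB (s.image (algebraMap A B))
  have hA : ∀ y : A, algebraMap A B y ∈ Algebra.adjoin ℤ_[p] {x} := by
    intro y
    have hle : Submodule.span ℤ_[p] (s : Set A) ≤ (Algebra.adjoin ℤ_[p] {x}).toSubmodule.comap
        (IsScalarTower.toAlgHom ℤ_[p] A B).toLinearMap := by
      rw [Submodule.span_le]
      intro z hz
      exact hx (by simpa using ⟨z, hz, rfl⟩)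
    rw [hs] at hle
    exact hle (Submodule.mem_top (x := y))
  obtain ⟨c, e, hc⟩ := exists_dvd_natCast_pow p
    (aeval_derivative_minpoly_ne_zero (R := ℤ_[p]) (Algebra.IsIntegral.isIntegral x))
  have hDx : (p : B) ^ c • KaehlerDifferential.D ℤ_[p] B x = 0 := by
    have h := (KaehlerDifferential.D ℤ_[p] B).map_aeval (minpoly ℤ_[p] x) x
    rw [minpoly.aeval, map_zero] at h
    rw [hc, mul_comm, mul_smul, ← h, smul_zero]
  have hDA (y : A) : (p : B) ^ c • KaehlerDifferential.D ℤ_[p] B (algebraMap A B y) = 0 := by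
    have h := hA y
    rw [Algebra.adjoin_singleton_eq_range_aeval] at h
    obtain ⟨q, hq⟩ := h
    change aeval x q = _ at hq
    rw [← hq, Derivation.map_aeval, smul_comm, hDx, smul_zero]
  let D' : Derivation A B (Ω[B⁄ℤ_[p]]) := Derivation.mk'
    { toFun := fun y => (p : B) ^ c • KaehlerDifferential.D ℤ_[p] B y
      map_add' := fun y z => by rw [map_add, smul_add]
      map_smul' := fun y z => by
        rw [Algebra.smul_def, Derivation.leibniz, smul_add, smul_comm _ z, hDA, smul_zero, add_zero,
          RingHom.id_apply, smul_comm, algebraMap_smul] }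
    (fun y z => by
      simp only [LinearMap.coe_mk, AddHom.coe_mk, Derivation.leibniz, smul_add]
      rw [smul_comm _ y, smul_comm _ z])
  refine ⟨c, fun y a h => ?_⟩
  have h2 := congrArg D'.liftKaehlerDifferential h
  rw [map_smul, Derivation.liftKaehlerDifferential_comp_D, map_zero] at h2
  rw [mul_comm, mul_smul]
  exact h2

theorem maximalIdeal_le_radical_span_natCast (p : ℕ) [Fact p.Prime] {S : Type*} [CommRing S]
    [IsLocalRing S] [Algebra ℤ_[p] S] [Algebra.IsIntegral ℤ_[p] S] :
    IsLocalRing.maximalIdeal S ≤ (Ideal.span {(p : S)}).radical := by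
  rw [Ideal.radical_eq_sInf]
  refine le_sInf fun P ⟨hle, hP⟩ => (IsLocalRing.eq_maximalIdeal ?_).ge
  refine Ideal.isMaximal_of_isIntegral_of_isMaximal_comap (R := ℤ_[p]) P ?_
  have h : IsLocalRing.maximalIdeal ℤ_[p] ≤ P.comap (algebraMap ℤ_[p] S) := by
    rw [PadicInt.maximalIdeal_eq_span_p, Ideal.span_singleton_le_iff_mem, Ideal.mem_comap,
      map_natCast]
    exact (Ideal.span_singleton_le_iff_mem _).1 hle
  rw [← (IsLocalRing.maximalIdeal.isMaximal ℤ_[p]).eq_of_le (Ideal.comap_isPrime _ _).ne_top h]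
  exact IsLocalRing.maximalIdeal.isMaximal _

theorem finite_residueField (p : ℕ) [Fact p.Prime] (S : Type*) [CommRing S]
    [IsLocalRing S] [Algebra ℤ_[p] S] [Module.Finite ℤ_[p] S] [FaithfulSMul ℤ_[p] S] :
    Finite (IsLocalRing.ResidueField S) := by
  have : Finite (IsLocalRing.ResidueField ℤ_[p]) :=
    Finite.of_equiv _ (PadicInt.residueField (p := p)).symm.toEquiv
  have : IsLocalHom (algebraMap ℤ_[p] S) :=
    (algebraMap_isIntegral_iff.2 inferInstance : (algebraMap ℤ_[p] S).IsIntegral).isLocalHom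
      (FaithfulSMul.algebraMap_injective _ _)
  exact Module.finite_of_finite (IsLocalRing.ResidueField ℤ_[p])

/-- In a local ring with principal maximal ideal and finite residue field, every residue class has
a lift `x` such that `x ^ q - x` generates the maximal ideal. -/
theorem exists_residue_eq_and_span_eq {S : Type*} [CommRing S] [IsLocalRing S]
    [Finite (IsLocalRing.ResidueField S)] (hS : (IsLocalRing.maximalIdeal S).IsPrincipal)
    (g : IsLocalRing.ResidueField S) :
    ∃ x : S, IsLocalRing.residue S x = g ∧ IsLocalRing.maximalIdeal S =
      Ideal.span {x ^ Nat.card (IsLocalRing.ResidueField S) - x} := by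
  have := Fintype.ofFinite (IsLocalRing.ResidueField S)
  obtain ⟨π, hπ⟩ := hS.principal
  have hπm : π ∈ IsLocalRing.maximalIdeal S := by
    rw [hπ]; exact Submodule.mem_span_singleton_self π
  set q := Nat.card (IsLocalRing.ResidueField S) with hq
  have hpow (a : IsLocalRing.ResidueField S) : a ^ q = a := by
    rw [hq, Nat.card_eq_fintype_card, FiniteField.pow_card]
  have hq2 : 2 ≤ q := Finite.one_lt_card
  have hmem (x : S) : x ^ q - x ∈ IsLocalRing.maximalIdeal S := by
    rw [← IsLocalRing.residue_eq_zero_iff, map_sub, map_pow, hpow, sub_self]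
  have hqm : (q : S) ∈ IsLocalRing.maximalIdeal S := by
    rw [← IsLocalRing.residue_eq_zero_iff, map_natCast, hq, Nat.card_eq_fintype_card,
      FiniteField.cast_card_eq_zero]
  have hunit (u : S) (hu : u ∉ IsLocalRing.maximalIdeal S) :
      IsLocalRing.maximalIdeal S = Ideal.span {u * π} := by
    rw [Ideal.span_singleton_mul_left_unit (by simpa using hu), hπ]
  obtain ⟨x, rfl⟩ := IsLocalRing.residue_surjective g
  obtain ⟨u, hu⟩ := Submodule.mem_span_singleton.1 (hπ ▸ hmem x)
  by_cases hum : u ∈ IsLocalRing.maximalIdeal S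
  · refine ⟨x + π, by rw [map_add, (IsLocalRing.residue_eq_zero_iff π).2 hπm, add_zero], ?_⟩
    obtain ⟨y, hy⟩ : ∃ y, (x + π) ^ q = x ^ q + q * x ^ (q - 1) * π + y * π ^ 2 := by
      obtain ⟨y, hy⟩ := Polynomial.powAddExpansion x π q
      exact ⟨y, hy⟩
    have : (x + π) ^ q - (x + π) = (u + q * x ^ (q - 1) + y * π - 1) * π := by
      rw [hy]
      rw [smul_eq_mul] at hu
      linear_combination -hu
    rw [this]
    apply hunit
    intro h
    apply (IsLocalRing.maximalIdeal.isMaximal S).ne_top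
    rw [Ideal.eq_top_iff_one]
    have h2 : u + q * x ^ (q - 1) + y * π ∈ IsLocalRing.maximalIdeal S :=
      Ideal.add_mem _ (Ideal.add_mem _ hum (Ideal.mul_mem_right _ _ hqm)) (Ideal.mul_mem_left _ _ hπm)
    simpa using Ideal.sub_mem _ h2 h
  · exact ⟨x, rfl, by rw [← hu]; exact hunit u hum⟩

/-- A local ring, finite and free over `ℤ_p`, with principal maximal ideal is monogenic. -/
theorem exists_adjoin_singleton_eq_top (p : ℕ) [Fact p.Prime] (S : Type*) [CommRing S]
    [IsLocalRing S] [Algebra ℤ_[p] S] [Module.Finite ℤ_[p] S] [FaithfulSMul ℤ_[p] S]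
    (hS : (IsLocalRing.maximalIdeal S).IsPrincipal) :
    ∃ x : S, Algebra.adjoin ℤ_[p] {x} = ⊤ := by
  have := finite_residueField p S
  obtain ⟨g, hg⟩ := IsCyclic.exists_generator (α := (IsLocalRing.ResidueField S)ˣ)
  obtain ⟨x, hx, hspan⟩ := exists_residue_eq_and_span_eq hS g
  refine ⟨x, ?_⟩
  set q := Nat.card (IsLocalRing.ResidueField S)
  set T := Algebra.adjoin ℤ_[p] {x} with hT
  have hxT : x ∈ T := Algebra.self_mem_adjoin_singleton _ _
  have hϖT : x ^ q - x ∈ T := T.sub_mem (T.pow_mem hxT _) hxT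
  have hres (s : S) : ∃ t ∈ T, s - t ∈ IsLocalRing.maximalIdeal S := by
    by_cases h0 : IsLocalRing.residue S s = 0
    · exact ⟨0, T.zero_mem, by rwa [sub_zero, ← IsLocalRing.residue_eq_zero_iff]⟩
    · obtain ⟨n, hn⟩ := (mem_powers_iff_mem_zpowers).2 (hg (Units.mk0 _ h0))
      refine ⟨x ^ n, T.pow_mem hxT n, ?_⟩
      have := congrArg Units.val hn
      simp only [Units.val_pow_eq_pow_val, Units.val_mk0] at this
      rw [← IsLocalRing.residue_eq_zero_iff, map_sub, map_pow, hx, ← this, sub_self]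
  have hexp (n : ℕ) (s : S) : ∃ t ∈ T, ∃ y, s = t + (x ^ q - x) ^ n * y := by
    induction n with
    | zero => exact ⟨0, T.zero_mem, s, by simp⟩
    | succ n ih =>
      obtain ⟨t, ht, y, rfl⟩ := ih
      obtain ⟨t', ht', hy⟩ := hres y
      rw [hspan] at hy
      obtain ⟨z, hz⟩ := Ideal.mem_span_singleton.1 hy
      refine ⟨t + (x ^ q - x) ^ n * t', T.add_mem ht (T.mul_mem (T.pow_mem hϖT n) ht'), z, ?_⟩
      rw [eq_add_of_sub_eq hz]
      ring
  have hϖ : x ^ q - x ∈ (Ideal.span {(p : S)}).radical :=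
    maximalIdeal_le_radical_span_natCast p (by rw [hspan]; exact Ideal.mem_span_singleton_self _)
  obtain ⟨n, hn⟩ := hϖ
  obtain ⟨w, hw⟩ := Ideal.mem_span_singleton.1 hn
  have hle : (⊤ : Submodule ℤ_[p] S) ≤ Subalgebra.toSubmodule T := by
    refine Submodule.le_of_le_smul_of_le_jacobson_bot (I := IsLocalRing.maximalIdeal ℤ_[p])
      Module.Finite.fg_top (IsLocalRing.jacobson_eq_maximalIdeal _ bot_ne_top).ge ?_
    intro s _
    obtain ⟨t, ht, y, rfl⟩ := hexp n s
    refine Submodule.add_mem_sup ht ?_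
    rw [hw]
    have : (p : S) * w * y = (p : ℤ_[p]) • (w * y) := by
      rw [Algebra.smul_def, map_natCast, mul_assoc]
    rw [this]
    refine Submodule.smul_mem_smul ?_ Submodule.mem_top
    rw [PadicInt.maximalIdeal_eq_span_p]; exact Ideal.mem_span_singleton_self _
  exact eq_top_iff.2 fun s _ => hle Submodule.mem_top

theorem isIntegral_of_spectralNorm_le_one (p : ℕ) [Fact p.Prime] {L : Type*} [Field L]
    [Algebra ℚ_[p] L] [Algebra ℤ_[p] L] [IsScalarTower ℤ_[p] ℚ_[p] L]
    [Algebra.IsAlgebraic ℚ_[p] L] {z : L} (hz : spectralNorm ℚ_[p] L z ≤ 1) :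
    IsIntegral ℤ_[p] z := by
  have hm : (minpoly ℚ_[p] z).Monic := minpoly.monic (Algebra.IsAlgebraic.isAlgebraic z).isIntegral
  have hlift : minpoly ℚ_[p] z ∈ lifts (algebraMap ℤ_[p] ℚ_[p]) := by
    rw [lifts_iff_coeff_lifts]
    intro n
    exact ⟨⟨_, (spectralValue_le_one_iff hm).1 hz n⟩, rfl⟩
  obtain ⟨f, hf, -, hfm⟩ := lifts_and_natDegree_eq_and_monic hlift hm
  refine ⟨f, hfm, ?_⟩
  rw [IsScalarTower.algebraMap_eq ℤ_[p] ℚ_[p] L, ← eval₂_map, hf]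
  exact minpoly.aeval _ _

theorem isIntegral_or_isIntegral_inv (p : ℕ) [Fact p.Prime] {L : Type*} [Field L]
    [Algebra ℚ_[p] L] [Algebra ℤ_[p] L] [IsScalarTower ℤ_[p] ℚ_[p] L]
    [Algebra.IsAlgebraic ℚ_[p] L] (z : L) : IsIntegral ℤ_[p] z ∨ IsIntegral ℤ_[p] z⁻¹ := by
  rcases eq_or_ne z 0 with rfl | hz
  · exact Or.inl isIntegral_zero
  rcases le_total (spectralNorm ℚ_[p] L z) 1 with h | h
  · exact Or.inl (isIntegral_of_spectralNorm_le_one p h)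
  · refine Or.inr (isIntegral_of_spectralNorm_le_one p ?_)
    have hmul := map_mul (spectralMulAlgNorm ℚ_[p] L) z z⁻¹
    rw [mul_inv_cancel₀ hz, map_one] at hmul
    simp only [spectralMulAlgNorm_def] at hmul
    by_contra! hlt
    have := one_lt_mul_of_le_of_lt h hlt
    exact this.ne hmul

theorem exists_mul_algebraMap_eq (p : ℕ) [Fact p.Prime] {B : Type*} (L : Type*)
    [CommRing B] [Field L]
    [Algebra ℚ_[p] L] [Algebra ℤ_[p] L] [IsScalarTower ℤ_[p] ℚ_[p] L]
    [Algebra.IsAlgebraic ℚ_[p] L] [Algebra ℤ_[p] B] [Algebra B L] [IsScalarTower ℤ_[p] B L]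
    [IsIntegralClosure B ℤ_[p] L] (a b : B) :
    ∃ c : B, (b = a * c ∧ algebraMap B L c = algebraMap B L b / algebraMap B L a) ∨
      (a = b * c ∧ algebraMap B L c = algebraMap B L a / algebraMap B L b) := by
  have hinj := IsIntegralClosure.algebraMap_injective B ℤ_[p] L
  have key (a b : B) (ha : a ≠ 0) (h : IsIntegral ℤ_[p] (algebraMap B L b / algebraMap B L a)) :
      ∃ c : B, b = a * c ∧ algebraMap B L c = algebraMap B L b / algebraMap B L a := by
    obtain ⟨c, hc⟩ := IsIntegralClosure.isIntegral_iff (A := B).1 h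
    refine ⟨c, hinj ?_, hc⟩
    have := (map_ne_zero_iff _ hinj).2 ha
    rw [map_mul, hc, mul_div_cancel₀ _ this]
  by_cases ha : a = 0
  · exact ⟨0, Or.inr (by simp [ha])⟩
  by_cases hb : b = 0
  · exact ⟨0, Or.inl (by simp [hb])⟩
  rcases isIntegral_or_isIntegral_inv p (algebraMap B L b / algebraMap B L a) with h | h
  · exact (key a b ha h).imp fun _ => Or.inl
  · rw [inv_div] at h
    exact (key b a hb h).imp fun _ => Or.inr

/-- Every finite set of elements of the ring of integers of an algebraic extension of `ℚ_p` is
contained in a monogenic `ℤ_p`-subalgebra. -/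
theorem exists_subset_adjoin_singleton (p : ℕ) [Fact p.Prime] {B : Type*} (L : Type*)
    [CommRing B] [Field L]
    [Algebra ℚ_[p] L] [Algebra ℤ_[p] L] [IsScalarTower ℤ_[p] ℚ_[p] L]
    [Algebra.IsAlgebraic ℚ_[p] L] [Algebra ℤ_[p] B] [Algebra B L] [IsScalarTower ℤ_[p] B L]
    [IsIntegralClosure B ℤ_[p] L] (s : Finset B) :
    ∃ x : B, (s : Set B) ⊆ Algebra.adjoin ℤ_[p] {x} := by
  classical
  have hinj := IsIntegralClosure.algebraMap_injective B ℤ_[p] L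
  have : IsDomain B := hinj.isDomain
  let F : IntermediateField ℚ_[p] L :=
    IntermediateField.adjoin ℚ_[p] (s.image (algebraMap B L) : Set L)
  have : FiniteDimensional ℚ_[p] F := IntermediateField.finiteDimensional_adjoin
    fun x _ => (Algebra.IsAlgebraic.isAlgebraic x).isIntegral
  let S : Subalgebra ℤ_[p] B :=
    (F.toSubalgebra.restrictScalars ℤ_[p]).comap (IsScalarTower.toAlgHom ℤ_[p] B L)
  have hmemS (y : B) : y ∈ S ↔ algebraMap B L y ∈ F := Iff.rfl
  have hsS : (s : Set B) ⊆ S := fun y hy =>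
    IntermediateField.subset_adjoin _ _ (by simpa using ⟨y, hy, rfl⟩)
  have : FaithfulSMul ℤ_[p] S := by
    rw [faithfulSMul_iff_algebraMap_injective]
    have h : Function.Injective (algebraMap ℤ_[p] L) := by
      rw [IsScalarTower.algebraMap_eq ℤ_[p] ℚ_[p] L]
      exact (algebraMap ℚ_[p] L).injective.comp (IsFractionRing.injective ℤ_[p] ℚ_[p])
    refine Function.Injective.of_comp (f := fun y : S => algebraMap B L y) ?_
    convert h using 1
    ext y
    exact (IsScalarTower.algebraMap_apply ℤ_[p] B L y).symm
  have : ValuationRing S := by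
    rw [ValuationRing.iff_dvd_total]
    refine ⟨fun a b => ?_⟩
    obtain ⟨c, ⟨h1, h2⟩ | ⟨h1, h2⟩⟩ := exists_mul_algebraMap_eq p L (a : B) b
    · exact Or.inl ⟨⟨c, (hmemS c).2 (h2 ▸ F.div_mem b.2 a.2)⟩, Subtype.ext h1⟩
    · exact Or.inr ⟨⟨c, (hmemS c).2 (h2 ▸ F.div_mem a.2 b.2)⟩, Subtype.ext h1⟩
  have : Module.Finite ℤ_[p] S := by
    have : Module.Finite ℤ_[p] (integralClosure ℤ_[p] F) :=
      IsIntegralClosure.finite ℤ_[p] ℚ_[p] F _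
    have : IsScalarTower ℤ_[p] F L := IsScalarTower.of_algebraMap_eq fun z => by
      rw [IsScalarTower.algebraMap_apply ℤ_[p] ℚ_[p] L z,
        IsScalarTower.algebraMap_apply ℤ_[p] ℚ_[p] F z]
      rfl
    have hbint (y : S) : IsIntegral ℤ_[p] (⟨algebraMap B L y, y.2⟩ : F) := by
      rw [← isIntegral_algebraMap_iff (algebraMap F L).injective]
      exact (IsIntegralClosure.isIntegral ℤ_[p] L (y : B)).map (IsScalarTower.toAlgHom ℤ_[p] B L)
    let φ : S →ₗ[ℤ_[p]] integralClosure ℤ_[p] F :=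
      { toFun := fun y => ⟨⟨algebraMap B L y, y.2⟩, hbint y⟩
        map_add' := fun y z => Subtype.ext (Subtype.ext (map_add (algebraMap B L) _ _))
        map_smul' := fun c y => Subtype.ext (Subtype.ext
          (map_smul (IsScalarTower.toAlgHom ℤ_[p] B L) c (y : B))) }
    refine Module.Finite.of_injective φ fun y z h => Subtype.ext (hinj ?_)
    exact congrArg (fun w : integralClosure ℤ_[p] F => ((w : F) : L)) h
  have : IsNoetherianRing S := IsNoetherianRing.of_finite ℤ_[p] S
  have : IsPrincipalIdealRing S := inferInstance
  obtain ⟨x, hx⟩ := exists_adjoin_singleton_eq_top p S (IsPrincipalIdealRing.principal _)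
  refine ⟨x, fun y hy => ?_⟩
  have := congrArg (Subalgebra.map S.val) hx
  rw [AlgHom.map_adjoin, Set.image_singleton, Algebra.map_top, Subalgebra.range_val] at this
  exact this.ge (hsS hy)

theorem exists_pow_dvd_of_smul_D_eq_zero (p : ℕ) [Fact p.Prime] (A : Type*) {B : Type*}
    [CommRing A] [CommRing B] [IsDomain B]
    [Algebra ℤ_[p] B] [Algebra.IsIntegral ℤ_[p] B] [FaithfulSMul ℤ_[p] B]
    (hB : ∀ s : Finset B, ∃ x : B, (s : Set B) ⊆ Algebra.adjoin ℤ_[p] {x})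
    [Algebra ℤ_[p] A] [Module.Finite ℤ_[p] A] [Algebra A B] [IsScalarTower ℤ_[p] A B] :
    ∃ c : ℕ, ∀ (r : ℕ) (ζ a : B), IsPrimitiveRoot ζ (p ^ r) →
      a • KaehlerDifferential.D A B ζ = 0 → (p : B) ^ r ∣ (p : B) ^ c * a := by
  obtain ⟨c, hc⟩ := exists_pow_smul_D_eq_zero p A hB
  refine ⟨c + 1, fun r ζ a hζ ha => ?_⟩
  rw [pow_succ', mul_assoc]
  exact pow_dvd_of_smul_D_eq_zero p hB hζ (hc ζ a ha)

theorem exists_eq_smul_D_of_subset_adjoin (R A : Type*) {B : Type*} [CommRing R] [CommRing A]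
    [CommRing B] [Algebra R A] [Algebra R B] [Algebra A B] [IsScalarTower R A B]
    (hB : ∀ s : Finset B, ∃ x : B, (s : Set B) ⊆ Algebra.adjoin R {x}) (ω η : Ω[B⁄A]) :
    ∃ x e b : B, ω = e • KaehlerDifferential.D A B x ∧ η = b • KaehlerDifferential.D A B x := by
  classical
  obtain ⟨u, rfl⟩ := KaehlerDifferential.linearCombination_surjective A B ω
  obtain ⟨v, rfl⟩ := KaehlerDifferential.linearCombination_surjective A B η
  obtain ⟨x, hx⟩ := hB (u.support ∪ v.support)
  rw [Finset.coe_union, Set.union_subset_iff] at hx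
  have hmem (w : B →₀ B) (hw : (w.support : Set B) ⊆ Algebra.adjoin R {x}) :
      ∃ e : B, Finsupp.linearCombination B (KaehlerDifferential.D A B) w =
        e • KaehlerDifferential.D A B x := by
    have : Finsupp.linearCombination B (KaehlerDifferential.D A B) w ∈
        Submodule.span B {KaehlerDifferential.D A B x} := by
      refine Submodule.sum_mem _ fun y hy => Submodule.smul_mem _ _ ?_
      have hy' := hw hy
      rw [Algebra.adjoin_singleton_eq_range_aeval] at hy'
      obtain ⟨f, rfl⟩ := hy'
      have := ((KaehlerDifferential.D A B).restrictScalars R).map_aeval f x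
      exact Submodule.mem_span_singleton.2 ⟨_, this.symm⟩
    obtain ⟨e, he⟩ := Submodule.mem_span_singleton.1 this
    exact ⟨e, he.symm⟩
  obtain ⟨e, he⟩ := hmem u hx.1
  obtain ⟨b, hb⟩ := hmem v hx.2
  exact ⟨x, e, b, he, hb⟩

/-- If the annihilator of `η` is contained in `(p ^ r)` up to `p ^ c`, then every `p ^ r`-torsion
differential is a multiple of `η` up to `p ^ (c + 1)`. -/
theorem exists_pow_smul_eq_smul (R A : Type*) {B : Type*} [CommRing R] [CommRing A]
    [CommRing B] [IsDomain B] [Algebra R A] [Algebra R B] [Algebra A B] [IsScalarTower R A B]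
    (hB : ∀ s : Finset B, ∃ x : B, (s : Set B) ⊆ Algebra.adjoin R {x})
    (hdvd : ∀ a b : B, a ∣ b ∨ b ∣ a) {π : B} (hπ0 : π ≠ 0) (hπ : ¬ IsUnit π) {c r : ℕ}
    {ω η : Ω[B⁄A]} (hη : ∀ a : B, a • η = 0 → π ^ r ∣ π ^ c * a) (hω : π ^ r • ω = 0) :
    ∃ a : B, π ^ (c + 1) • ω = a • η := by
  rcases lt_or_ge r (c + 1) with hr | hr
  · refine ⟨0, ?_⟩
    rw [← Nat.sub_add_cancel hr.le, pow_add, mul_smul, hω, smul_zero, zero_smul]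
  obtain ⟨x, e, b, rfl, rfl⟩ := exists_eq_smul_D_of_subset_adjoin R A hB ω η
  rcases hdvd b (π ^ (c + 1) * e) with ⟨m, hm⟩ | ⟨m, hm⟩
  · exact ⟨m, by rw [smul_smul, hm, smul_smul, mul_comm]⟩
  · exfalso
    have h0 : π ^ (r - (c + 1)) • b • KaehlerDifferential.D A B x = 0 := by
      have h1 : π ^ (r - (c + 1)) * π ^ (c + 1) = π ^ r := by
        rw [← pow_add, Nat.sub_add_cancel hr]
      have h2 : π ^ (r - (c + 1)) * b = m * (π ^ r * e) := by
        rw [hm, ← h1]; ring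
      rw [smul_smul, h2, mul_smul, mul_smul, hω, smul_zero]
    have h3 := hη _ h0
    rw [← pow_add] at h3
    have := (pow_dvd_pow_iff hπ0 hπ).1 h3
    omega

end Differentials

theorem TateModule.pow_smul_apply {p : ℕ} {B M : Type*} [CommRing B] [AddCommGroup M] [Module B M]
    (t : TateModule p B M) (r k : ℕ) : (p : B) ^ k • (t : ℕ → M) (r + k) = (t : ℕ → M) r := by
  induction k with
  | zero => simp
  | succ k ih =>
    rw [pow_succ, mul_smul, ← add_assoc, Nat.cast_smul_eq_nsmul, t.2.1, ih]

theorem TateModule.pow_smul_apply_self {p : ℕ} {B M : Type*} [CommRing B] [AddCommGroup M]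
    [Module B M] (t : TateModule p B M) (r : ℕ) : (p : B) ^ r • (t : ℕ → M) r = 0 := by
  rw [← Nat.cast_pow, Nat.cast_smul_eq_nsmul, t.2.2]

section Completion

variable {p : ℕ} {B M C : Type*} [CommRing B] [AddCommGroup M] [Module B M] [CommRing C]
  {ρ : B →+* C} [Module C (TateModule p B M)]

/-- The `r`-th component of the action of the completion on a Tate module is computed by any
approximation modulo `p ^ r`. -/
theorem TateModule.smul_apply_of_sub_mem
    (hcompat : ∀ (a : B) (x : TateModule p B M), ρ a • x = a • x) {a : C} {b : B} {n r : ℕ}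
    (hr : r ≤ n) (hab : a - ρ b ∈ Ideal.span {(p : C) ^ n}) (t : TateModule p B M) :
    ((a • t : TateModule p B M) : ℕ → M) r = b • (t : ℕ → M) r := by
  obtain ⟨d, hd⟩ := Ideal.mem_span_singleton.1 hab
  have ha : a = ρ b + ρ ((p : B) ^ n) * d := by
    rw [map_pow, map_natCast]; exact sub_eq_iff_eq_add'.1 hd
  obtain ⟨k, rfl⟩ := Nat.exists_eq_add_of_le' hr
  rw [ha, add_smul, mul_smul, hcompat, hcompat, Submodule.coe_add, Pi.add_apply,
    Submodule.coe_smul, Submodule.coe_smul, Pi.smul_apply, Pi.smul_apply, pow_add, mul_smul,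
    TateModule.pow_smul_apply_self, smul_zero, add_zero]

theorem TateModule.smul_eq_zero_of_pow_dvd [IsDomain B] (hp : (p : B) ≠ 0)
    (hdense : ∀ (x : C) (n : ℕ), ∃ y : B, x - ρ y ∈ Ideal.span {(p : C) ^ n})
    [IsHausdorff (Ideal.span {(p : C)}) C]
    (hcompat : ∀ (a : B) (x : TateModule p B M), ρ a • x = a • x) {t : TateModule p B M} {c : ℕ}
    (ht : ∀ (r : ℕ) (a : B), a • (t : ℕ → M) r = 0 → (p : B) ^ r ∣ (p : B) ^ c * a)
    {a : C} (ha : a • t = 0) : a = 0 := by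
  refine IsHausdorff.haus ‹IsHausdorff (Ideal.span {(p : C)}) C› a fun n => ?_
  rw [SModEq.zero, smul_eq_mul, Ideal.mul_top, Ideal.span_singleton_pow]
  obtain ⟨y, hy⟩ := hdense a (n + c)
  have h := TateModule.smul_apply_of_sub_mem hcompat le_rfl hy t
  rw [ha, Submodule.coe_zero, Pi.zero_apply] at h
  have hdvd := ht _ _ h.symm
  rw [add_comm, pow_add, mul_dvd_mul_iff_left (pow_ne_zero _ hp)] at hdvd
  have hy' : ρ y ∈ Ideal.span {(p : C) ^ n} := by
    rw [Ideal.mem_span_singleton]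
    simpa using map_dvd ρ hdvd
  rw [← sub_add_cancel a (ρ y)]
  refine Ideal.add_mem _ (Ideal.span_singleton_le_span_singleton.2 ?_ hy) hy'
  exact pow_dvd_pow _ (Nat.le_add_right _ _)

theorem TateModule.exists_pow_smul_eq_smul [IsDomain B] (hp : (p : B) ≠ 0)
    [IsPrecomplete (Ideal.span {(p : C)}) C]
    (hcompat : ∀ (a : B) (x : TateModule p B M), ρ a • x = a • x) {t : TateModule p B M} {c k : ℕ}
    (ht : ∀ (r : ℕ) (a : B), a • (t : ℕ → M) r = 0 → (p : B) ^ r ∣ (p : B) ^ c * a)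
    (hx : ∀ (r : ℕ) (x : M), (p : B) ^ r • x = 0 → ∃ a : B, (p : B) ^ k • x = a • (t : ℕ → M) r)
    (x : TateModule p B M) : ∃ a : C, (p : C) ^ k • x = a • t := by
  choose a ha using fun r => hx r ((x : ℕ → M) r) (TateModule.pow_smul_apply_self x r)
  have hstep (r j : ℕ) : a (r + j) • (t : ℕ → M) r = (p : B) ^ k • (x : ℕ → M) r := by
    rw [← TateModule.pow_smul_apply t r j, smul_comm, ← ha, smul_comm,
      TateModule.pow_smul_apply]
  have hcauchy {m n : ℕ} (hmn : m ≤ n) : (p : B) ^ m ∣ a (m + c) - a (n + c) := by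
    obtain ⟨j, rfl⟩ := Nat.exists_eq_add_of_le hmn
    have h : (a (m + c) - a (m + j + c)) • (t : ℕ → M) (m + c) = 0 := by
      have h1 := hstep (m + c) 0
      have h2 := hstep (m + c) j
      rw [add_zero] at h1
      rw [add_right_comm] at h2
      rw [sub_smul, h1, h2, sub_self]
    have := ht _ _ h
    rwa [add_comm m c, pow_add, mul_dvd_mul_iff_left (pow_ne_zero _ hp), add_comm c m] at this
  obtain ⟨l, hl⟩ := IsPrecomplete.prec ‹IsPrecomplete (Ideal.span {(p : C)}) C›
    (f := fun n => ρ (a (n + c))) fun {m n} hmn => by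
      rw [SModEq.sub_mem, smul_eq_mul, Ideal.mul_top, Ideal.span_singleton_pow,
        Ideal.mem_span_singleton, ← map_sub]
      simpa using map_dvd ρ (hcauchy hmn)
  refine ⟨l, Subtype.ext (funext fun r => ?_)⟩
  have hlr : l - ρ (a (r + c)) ∈ Ideal.span {(p : C) ^ r} := by
    have := hl r
    rwa [SModEq.comm, SModEq.sub_mem, smul_eq_mul, Ideal.mul_top, Ideal.span_singleton_pow] at this
  have hpk : (p : C) ^ k = ρ ((p : B) ^ k) := by rw [map_pow, map_natCast]
  rw [TateModule.smul_apply_of_sub_mem hcompat le_rfl hlr, hstep, hpk, hcompat]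
  rfl

end Completion

/-- Let `K` be a finite extension of `ℚ_p` with ring of integers
`O_K` and `O_K̄` the ring of integers of an algebraic closure `K̄`; let `O_{C_K}` be
the `p`-adic completion of `O_K̄` (axiomatized via `ρ`), acting canonically on the
Tate module `T_p(Ω¹_{O_K̄/O_K})`.  The map `ℤ_p(1) → T_p(Ω¹_{O_K̄/O_K})` induced by
`dlog` on `p^r`-torsion extends, after scalar extension along `ℤ_p → C_K`, to an
isomorphism of `C_K`-vector spaces `C_K ⊗_{ℤ_p} ℤ_p(1) ≅ V_p(Ω¹_{O_K̄/O_K})`: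
concretely, for every compatible system `ζ = (ζ_r)` of primitive `p^r`-th roots of
unity (a generator of `ℤ_p(1)`), the element `t = (dlog ζ_r)_r = (ζ_r⁻¹ · dζ_r)_r`
of the Tate module becomes a basis of `V_p(Ω¹) = T_p(Ω¹)[1/p]` over
`C_K = O_{C_K}[1/p]`. -/
theorem dlog_induces_iso_CK_one_with_Vp_kaehler
    (p : ℕ) [Fact p.Prime]
    (K : Type*) [Field K] [Algebra ℚ_[p] K] [FiniteDimensional ℚ_[p] K]
    (Kbar : Type*) [Field Kbar] [Algebra K Kbar] [IsAlgClosure K Kbar]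
    [Algebra ℤ_[p] K] [IsScalarTower ℤ_[p] ℚ_[p] K]
    [Algebra ℚ_[p] Kbar] [Algebra ℤ_[p] Kbar]
    [IsScalarTower ℤ_[p] ℚ_[p] Kbar] [IsScalarTower ℚ_[p] K Kbar]
    (OK : Type*) [CommRing OK] [Algebra ℤ_[p] OK] [Algebra OK K]
    [IsScalarTower ℤ_[p] OK K] [IsIntegralClosure OK ℤ_[p] K]
    (OKbar : Type*) [CommRing OKbar] [Algebra ℤ_[p] OKbar] [Algebra OKbar Kbar]
    [IsScalarTower ℤ_[p] OKbar Kbar] [IsIntegralClosure OKbar ℤ_[p] Kbar]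
    [Algebra OK OKbar] [Algebra OK Kbar] [IsScalarTower OK K Kbar]
    [IsScalarTower OK OKbar Kbar]
    -- `O_{C_K}`, the `p`-adic completion of `O_K̄` :
    (OCK : Type*) [CommRing OCK] (ρ : OKbar →+* OCK)
    (hρ_inj : Function.Injective ρ)
    (hρ_dense : ∀ (x : OCK) (n : ℕ), ∃ y : OKbar,
      x - ρ y ∈ Ideal.span {(p : OCK) ^ n})
    (hρ_mod : ∀ (y : OKbar) (n : ℕ), ρ y ∈ Ideal.span {(p : OCK) ^ n} →
      y ∈ Ideal.span {(p : OKbar) ^ n})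
    (hcomplete : IsAdicComplete (Ideal.span {(p : OCK)}) OCK)
    -- the canonical `O_{C_K}`-module structure on the Tate module :
    [Module OCK (TateModule p OKbar (KaehlerDifferential OK OKbar))]
    (hcompat : ∀ (a : OKbar) (x : TateModule p OKbar (KaehlerDifferential OK OKbar)),
      ρ a • x = a • x)
    -- a compatible system of primitive `p^r`-th roots of unity :
    (ζ : ℕ → OKbar) (hζprim : ∀ r, IsPrimitiveRoot (ζ r) (p ^ r))
    (hζcomp : ∀ r, ζ (r + 1) ^ p = ζ r)
    -- the image of the corresponding generator of `ℤ_p(1)` under `dlog` :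
    (t : TateModule p OKbar (KaehlerDifferential OK OKbar))
    (ht : ∀ r, (t : ℕ → KaehlerDifferential OK OKbar) r =
      (ζ r ^ (p ^ r - 1)) • KaehlerDifferential.D OK OKbar (ζ r)) :
    (∀ x : TateModule p OKbar (KaehlerDifferential OK OKbar),
      ∃ (a : OCK) (n : ℕ), (p : OCK) ^ n • x = a • t) ∧
    (∀ a : OCK, a • t = 0 → a = 0) := by
  have hinj := IsIntegralClosure.algebraMap_injective OKbar ℤ_[p] Kbar
  have hinjZ : Function.Injective (algebraMap ℤ_[p] Kbar) := by
    rw [IsScalarTower.algebraMap_eq ℤ_[p] ℚ_[p] Kbar]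
    exact (algebraMap ℚ_[p] Kbar).injective.comp (IsFractionRing.injective ℤ_[p] ℚ_[p])
  have : IsDomain OKbar := hinj.isDomain
  have : FaithfulSMul ℤ_[p] OKbar := by
    rw [faithfulSMul_iff_algebraMap_injective]
    rw [IsScalarTower.algebraMap_eq ℤ_[p] OKbar Kbar, RingHom.coe_comp] at hinjZ
    exact hinjZ.of_comp
  have : Algebra.IsIntegral ℤ_[p] OKbar := IsIntegralClosure.isIntegral_algebra ℤ_[p] Kbar
  have : Algebra.IsAlgebraic K Kbar := IsAlgClosure.isAlgebraic
  have : Algebra.IsAlgebraic ℚ_[p] Kbar := Algebra.IsAlgebraic.trans ℚ_[p] K Kbar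
  have : IsScalarTower ℤ_[p] OK OKbar := IsScalarTower.of_algebraMap_eq fun z => hinj <| by
    rw [← IsScalarTower.algebraMap_apply ℤ_[p] OKbar Kbar,
      ← IsScalarTower.algebraMap_apply OK OKbar Kbar, IsScalarTower.algebraMap_apply OK K Kbar,
      ← IsScalarTower.algebraMap_apply ℤ_[p] OK K, IsScalarTower.algebraMap_apply ℤ_[p] ℚ_[p] K,
      ← IsScalarTower.algebraMap_apply ℚ_[p] K Kbar,
      ← IsScalarTower.algebraMap_apply ℤ_[p] ℚ_[p] Kbar]
  have : Module.Finite ℤ_[p] OK := IsIntegralClosure.finite ℤ_[p] ℚ_[p] K OK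
  have hp0 : (p : OKbar) ≠ 0 := by
    rw [← map_natCast (algebraMap ℤ_[p] OKbar),
      map_ne_zero_iff _ (FaithfulSMul.algebraMap_injective ℤ_[p] OKbar)]
    exact_mod_cast (Fact.out : p.Prime).ne_zero
  have hpu : ¬ IsUnit (p : OKbar) := fun h => by
    obtain ⟨m, hm⟩ := Ideal.exists_maximal OKbar
    exact hm.ne_top (Ideal.eq_top_of_isUnit_mem _ (natCast_mem_of_isMaximal p m) h)
  have hmono := exists_subset_adjoin_singleton p (B := OKbar) Kbar
  have hdvd (a b : OKbar) : a ∣ b ∨ b ∣ a := by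
    obtain ⟨c, ⟨h, -⟩ | ⟨h, -⟩⟩ := exists_mul_algebraMap_eq p Kbar a b
    exacts [Or.inl ⟨c, h⟩, Or.inr ⟨c, h⟩]
  obtain ⟨c, hc⟩ := exists_pow_dvd_of_smul_D_eq_zero p OK hmono
  have hann (r : ℕ) (a : OKbar) (h : a • (t : ℕ → KaehlerDifferential OK OKbar) r = 0) :
      (p : OKbar) ^ r ∣ (p : OKbar) ^ c * a := by
    refine hc r (ζ r) a (hζprim r) ?_
    have hζ : ζ r * ζ r ^ (p ^ r - 1) = 1 := by
      rw [mul_pow_sub_one (pow_ne_zero _ (Fact.out : p.Prime).ne_zero), (hζprim r).pow_eq_one]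
    rw [← one_smul OKbar (KaehlerDifferential.D OK OKbar (ζ r)), ← hζ, mul_smul, ← ht, smul_comm,
      h, smul_zero]
  refine ⟨fun x => ?_, fun a ha => TateModule.smul_eq_zero_of_pow_dvd hp0 hρ_dense hcompat hann ha⟩
  obtain ⟨a, ha⟩ := TateModule.exists_pow_smul_eq_smul hp0 hcompat hann
    (fun r x hx => exists_pow_smul_eq_smul ℤ_[p] OK hmono hdvd hp0 hpu (hann r) hx) x
  exact ⟨a, c + 1, ha⟩
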